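/- Under the Section 4 setup (pseudo-gradient flow φ for f on a Banach space E, index pair (N,L) with V = cl(N − L), f bounded on V, Palais–Smale in V, no critical points of f in L ∩ V), suppose in addition that (N,L) is a regular index pair, x_1, …, x_n are exactly the critical points of f in V, and for each i let U_i be a neighborhood of x_i in N with U_i ⊆ N − L. Then there exist t_0, t_1, …, t_n ≥ 0 such that N = (φ_♮^{t_0})^{-1}(L) ∪ ⋃_{i=1}^n (φ_♮^{t_i})^{-1}(U_i), where φ_♮ is the stopped semiflow on N. -/

import Mathlib

open scoped ENNReal

/-- The exit time map `τ₊ : N → [0,∞]` of the pair `(N, L)`: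
`τ₊(x) = sup {t ≥ 0 | φ^{[0,t]}(x) ⊆ N − L}` for `x ∈ N − L` and `τ₊(x) = 0` for `x ∈ L`
(for `x ∈ L` the set below is empty, so the supremum is `0`). -/
noncomputable def tauPlus {X : Type*} (φ : ℝ → X → X) (N L : Set X) (x : N) : ℝ≥0∞ :=
  sSup (ENNReal.ofReal '' {r : ℝ | 0 ≤ r ∧ ∀ s ∈ Set.Icc 0 r, φ s (x : X) ∈ N \ L})

open Set Filter Topology

/-- The Palais–Smale condition bounds the differential from below away from the critical points. -/
lemma exists_pos_le_norm_fderiv_of_palaisSmale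
    {E : Type*} [NormedAddCommGroup E] [NormedSpace ℝ E] {f : E → ℝ} (hf : ContDiff ℝ 1 f)
    {V : Set E} (hV : IsClosed V) (hfb : ∃ C, ∀ z ∈ V, |f z| ≤ C)
    (hPS : ∀ u : ℕ → E, (∀ n, u n ∈ V) → (∃ C, ∀ n, |f (u n)| ≤ C) →
      Tendsto (fun n => ‖fderiv ℝ f (u n)‖) atTop (𝓝 0) →
      ∃ x : E, ∃ σ : ℕ → ℕ, StrictMono σ ∧ Tendsto (u ∘ σ) atTop (𝓝 x))
    {ι : Type*} {x : ι → E} (hx : ∀ z ∈ V, fderiv ℝ f z = 0 → ∃ i, x i = z)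
    {ρ : ℝ} (hρ : 0 < ρ) :
    ∃ δ > 0, ∀ z ∈ V, (∀ i, ρ ≤ dist z (x i)) → δ ≤ ‖fderiv ℝ f z‖ := by
  by_contra! h
  choose u huV hud hu using fun k : ℕ => h (1 / ((k : ℝ) + 1)) Nat.one_div_pos_of_nat
  have hlim : Tendsto (fun n => ‖fderiv ℝ f (u n)‖) atTop (𝓝 0) :=
    squeeze_zero (fun _ => norm_nonneg _) (fun k => (hu k).le) tendsto_one_div_add_atTop_nhds_zero_nat
  obtain ⟨p, σ, hσ, hp⟩ := hPS u huV (hfb.imp fun C hC k => hC _ (huV k)) hlim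
  have hpV : p ∈ V := hV.mem_of_tendsto hp (Eventually.of_forall fun k => huV _)
  have hDf : Continuous fun z => ‖fderiv ℝ f z‖ := (hf.continuous_fderiv one_ne_zero).norm
  have hp0 : ‖fderiv ℝ f p‖ = 0 :=
    tendsto_nhds_unique ((hDf.tendsto p).comp hp) (hlim.comp hσ.tendsto_atTop)
  obtain ⟨i, rfl⟩ := hx p hpV (norm_eq_zero.mp hp0)
  have hle : ρ ≤ dist (x i) (x i) :=
    ge_of_tendsto (hp.dist tendsto_const_nhds) (Eventually.of_forall fun k => hud _ i)
  rw [dist_self] at hle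
  exact hρ.not_ge hle

lemma mul_sub_le_sub_of_le_hasDerivAt {g g' : ℝ → ℝ} {a b m : ℝ} (hab : a ≤ b)
    (hg : ∀ t, HasDerivAt g (g' t) t) (hm : ∀ t ∈ Ioo a b, m ≤ g' t) :
    m * (b - a) ≤ g b - g a := by
  refine (convex_Icc a b).mul_sub_le_image_sub_of_le_deriv
    (fun t _ => (hg t).continuousAt.continuousWithinAt)
    (fun t _ => (hg t).differentiableAt.differentiableWithinAt) (fun t ht => ?_)
    a (left_mem_Icc.mpr hab) b (right_mem_Icc.mpr hab) hab
  rw [(hg t).deriv]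
  exact hm t (by simpa using ht)

/-- A function that grows at rate at least `m` while a curve of speed at most `C` is in an annulus
of width `r / 2` gains at least `m * (r / (2 * C))` when the curve crosses the annulus. -/
lemma add_le_of_crossing_annulus
    {E : Type*} [NormedAddCommGroup E] [NormedSpace ℝ E]
    {c c' : ℝ → E} {g g' : ℝ → ℝ} {C m r s t : ℝ} {p : E} (hC : 0 < C) (hm : 0 ≤ m)
    (hc : ∀ u, HasDerivAt c (c' u) u) (hcC : ∀ u, ‖c' u‖ ≤ C)
    (hg : ∀ u, HasDerivAt g (g' u) u) (hg0 : ∀ u, 0 ≤ g' u)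
    (hgm : ∀ u ∈ Icc s t, r / 2 ≤ dist (c u) p → dist (c u) p ≤ r → m ≤ g' u)
    (hst : s ≤ t) (hs : dist (c s) p ≤ r / 2) (ht : r ≤ dist (c t) p) :
    g s + m * (r / (2 * C)) ≤ g t := by
  have hd : Continuous fun u => dist (c u) p :=
    (continuous_iff_continuousAt.mpr fun u => (hc u).continuousAt).dist continuous_const
  obtain ⟨b, ⟨⟨hsb, hbt⟩, hb⟩, hbmin⟩ :=
    (isCompact_Icc.inter_right (isClosed_le continuous_const hd) :
      IsCompact (Icc s t ∩ {u | r ≤ dist (c u) p})).exists_isLeast ⟨t, ⟨hst, le_rfl⟩, ht⟩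
  obtain ⟨a, ⟨⟨hsa, hab⟩, ha⟩, hamax⟩ :=
    (isCompact_Icc.inter_right (isClosed_le hd continuous_const) :
      IsCompact (Icc s b ∩ {u | dist (c u) p ≤ r / 2})).exists_isGreatest
      ⟨s, ⟨le_rfl, hsb⟩, hs⟩
  simp only [mem_ofPred_eq] at ha hb
  have hmono : ∀ {v w}, v ≤ w → g v ≤ g w := fun hvw => by
    simpa using mul_sub_le_sub_of_le_hasDerivAt (m := 0) hvw hg fun u _ => hg0 u
  have hgain : m * (b - a) ≤ g b - g a := by
    refine mul_sub_le_sub_of_le_hasDerivAt hab hg fun u hu => ?_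
    refine hgm u ⟨hsa.trans hu.1.le, hu.2.le.trans hbt⟩ ?_ ?_
    · by_contra! h
      exact hu.1.not_ge (hamax ⟨⟨hsa.trans hu.1.le, hu.2.le⟩, h.le⟩)
    · by_contra! h
      exact hu.2.not_ge (hbmin ⟨⟨hsa.trans hu.1.le, hu.2.le.trans hbt⟩, h.le⟩)
  have hspeed : dist (c b) (c a) ≤ C * (b - a) := by
    have := (convex_univ (𝕜 := ℝ)).norm_image_sub_le_of_norm_hasDerivWithin_le
      (fun u _ => (hc u).hasDerivWithinAt) (fun u _ => hcC u) (mem_univ a) (mem_univ b)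
    rwa [← dist_eq_norm, Real.norm_of_nonneg (sub_nonneg.mpr hab)] at this
  have htime : r / (2 * C) ≤ b - a := by
    rw [div_le_iff₀ (by positivity)]
    linarith [dist_triangle (c b) (c a) p]
  linarith [mul_le_mul_of_nonneg_left htime hm, hmono hsa, hmono hbt]

/-- If the sets `W i` can only be visited in strictly increasing order of `val i` once the larger
set `B i` has been left, and some `W i` is visited in every time window of length `K`, then at one of
the times `K, 2 * K, …, n * K` the curve lies in the correspondingly ranked `B i`. -/
lemma exists_mem_at_ranked_time {X : Type*} {n : ℕ} {c : ℝ → X} {W B : Fin n → Set X}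
    {val : Fin n → ℝ} {e : Equiv.Perm (Fin n)} (he : Monotone (val ∘ e)) {K : ℝ} (hK : 0 ≤ K)
    (hdisj : ∀ i j, i ≠ j → Disjoint (B i) (W j))
    (hpass : ∀ i j v t u, 0 ≤ v → v ≤ t → t ≤ u → u ≤ (n + 1) * K →
      c v ∈ W i → c t ∉ B i → c u ∈ W j → val i < val j)
    (hhit : ∀ a, 0 ≤ a → a + K ≤ (n + 1) * K → ∃ v ∈ Icc a (a + K), ∃ i, c v ∈ W i) :
    ∃ k : Fin n, c (((k : ℕ) + 1) * K) ∈ B (e k) := by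
  by_contra! hB
  have avoid : ∀ k : ℕ, k ≤ n → ∀ u, k * K ≤ u → u ≤ (n + 1) * K →
      ∀ j : Fin n, (j : ℕ) < k → c u ∉ W (e j) := by
    intro k
    induction k with
    | zero => intro _ _ _ _ j hj; omega
    | succ k ih =>
      intro hk u hu huT l hl hlW
      push_cast at hu
      have hu' : k * K + K ≤ u := by linarith
      obtain hlk | hlk : (l : ℕ) < k ∨ (l : ℕ) = k := by omega
      · exact ih (by omega) u (by linarith) huT l hlk hlW
      have hkK : 0 ≤ (k : ℝ) * K := by positivity
      obtain ⟨v, ⟨hv1, hv2⟩, i, hi⟩ := hhit (k * K) hkK (by linarith)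
      obtain ⟨j, rfl⟩ := e.surjective i
      have hlB := hB l
      rw [hlk] at hlB
      by_cases hjl : j = l
      · subst hjl
        exact (hpass _ _ v _ u (by linarith) (by linarith) (by linarith) huT hi hlB hlW).false
      · have hjk : ¬ (j : ℕ) < k := fun h =>
          ih (by omega) v hv1 (by linarith) j h hi
        have hlj : l ≤ j := by
          rw [Fin.le_def]; omega
        refine (hpass _ _ v u u (by linarith) (by linarith) le_rfl huT hi ?_ hlW).not_ge (he hlj)
        exact fun h => (hdisj _ _ (e.injective.ne hjl)).le_bot ⟨h, hlW⟩
  obtain ⟨v, ⟨hv1, hv2⟩, i, hi⟩ := hhit (n * K) (by positivity) (by linarith)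
  obtain ⟨j, rfl⟩ := e.surjective i
  exact avoid n le_rfl v hv1 (by linarith) j j.2 hi

lemma mem_diff_of_lt_tauPlus {X : Type*} {φ : ℝ → X → X} {N L : Set X} {z : N} {t : ℝ}
    (ht : ENNReal.ofReal t < tauPlus φ N L z) {s : ℝ} (hs0 : 0 ≤ s) (hst : s ≤ t) :
    φ s (z : X) ∈ N \ L := by
  obtain ⟨_, ⟨r, ⟨-, hr⟩, rfl⟩, htr⟩ := lt_sSup_iff.mp ht
  exact hr s ⟨hs0, hst.trans (ENNReal.ofReal_lt_ofReal_iff'.mp htr).1.le⟩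

/-- A point with finite exit time is in the exit set at its exit time. -/
lemma apply_tauPlus_mem {X : Type*} [TopologicalSpace X] {φ : ℝ → X → X} {N L : Set X}
    (hφc : ∀ x, Continuous fun t => φ t x) (hφ0 : ∀ x, φ 0 x = x)
    (hφadd : ∀ s t x, φ (s + t) x = φ s (φ t x)) (hN : IsClosed N) (hL : IsClosed L)
    (hexit : ∀ x ∈ N, ¬ (∀ t ≥ (0 : ℝ), φ t x ∈ N) →
      ∃ t ≥ (0 : ℝ), (∀ s ∈ Icc 0 t, φ s x ∈ N) ∧ φ t x ∈ L)
    {z : N} (hz : tauPlus φ N L z ≠ ∞) : φ (tauPlus φ N L z).toReal (z : X) ∈ L := by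
  set T := (tauPlus φ N L z).toReal
  have hT0 : 0 ≤ T := ENNReal.toReal_nonneg
  have hofT : ENNReal.ofReal T = tauPlus φ N L z := ENNReal.ofReal_toReal hz
  by_contra hTL
  have hbefore : ∀ s, 0 ≤ s → s < T → φ s (z : X) ∈ N \ L := fun s hs hsT =>
    mem_diff_of_lt_tauPlus
      (by rw [← hofT]; exact (ENNReal.ofReal_lt_ofReal_iff (hs.trans_lt hsT)).mpr hsT) hs le_rfl
  have hTN : φ T (z : X) ∈ N := by
    rcases hT0.eq_or_lt with h0 | h0
    · rw [← h0, hφ0]; exact z.2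
    · refine hN.mem_of_tendsto (b := 𝓝[<] T) ((hφc z).continuousAt.mono_left nhdsWithin_le_nhds) ?_
      filter_upwards [Ioo_mem_nhdsLT h0] with s hs
      exact (hbefore s hs.1.le hs.2).1
  obtain ⟨t, ht0, ht⟩ : ∃ t > 0, ∀ s ∈ Icc 0 t, φ s (φ T z) ∈ N := by
    by_cases h : ∀ t ≥ (0 : ℝ), φ t (φ T z) ∈ N
    · exact ⟨1, one_pos, fun s hs => h s hs.1⟩
    · obtain ⟨t, ht0, htN, htL⟩ := hexit _ hTN h
      refine ⟨t, lt_of_le_of_ne ht0 ?_, htN⟩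
      rintro rfl
      exact hTL (by rwa [hφ0] at htL)
  have hev : ∀ᶠ s in 𝓝 (0 : ℝ), φ s (φ T z) ∉ L := by
    refine (hφc (φ T z)).continuousAt.eventually (hL.isOpen_compl.mem_nhds ?_)
    simpa only [hφ0, mem_compl_iff] using hTL
  obtain ⟨ε, hε, hεL⟩ := Metric.eventually_nhds_iff.mp hev
  have hmem : T + min t (ε / 2) ∈ {r : ℝ | 0 ≤ r ∧ ∀ s ∈ Icc 0 r, φ s (z : X) ∈ N \ L} := by
    refine ⟨by positivity, fun s hs => ?_⟩
    rcases lt_or_ge s T with hsT | hsT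
    · exact hbefore s hs.1 hsT
    have hs1 : s - T ≤ t := by linarith [hs.2, min_le_left t (ε / 2)]
    have hs2 : s - T ≤ ε / 2 := by linarith [hs.2, min_le_right t (ε / 2)]
    rw [← sub_add_cancel s T, hφadd]
    refine ⟨ht _ ⟨by linarith, hs1⟩, hεL ?_⟩
    rw [Real.dist_eq, sub_zero, abs_of_nonneg (by linarith)]
    linarith
  have hle : ENNReal.ofReal (T + min t (ε / 2)) ≤ tauPlus φ N L z :=
    le_sSup (mem_image_of_mem _ hmem)
  rw [← hofT, ENNReal.ofReal_le_ofReal_iff hT0] at hle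
  have : 0 < min t (ε / 2) := by positivity
  linarith

theorem stmt17
    {E : Type*} [NormedAddCommGroup E] [NormedSpace ℝ E] [CompleteSpace E]
    (f : E → ℝ) (hf : ContDiff ℝ 1 f)
    -- α : [0,∞) → [0,∞) is strictly increasing and continuous with α(0) = 0
    (α : ℝ → ℝ) (hα1 : StrictMonoOn α (Set.Ici 0))
    (hα2 : ContinuousOn α (Set.Ici 0)) (hα3 : α 0 = 0)
    (hα4 : ∀ r : ℝ, 0 ≤ r → 0 ≤ α r)
    -- Y is a pseudo-gradient vector field for f
    (Y : E → E) (hYb : ∃ C, ∀ x, ‖Y x‖ ≤ C)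
    (hYg : ∀ x, α ‖fderiv ℝ f x‖ ≤ fderiv ℝ f x (Y x))
    (hY0 : ∀ x, fderiv ℝ f x = 0 → Y x = 0)
    -- φ is the flow of Y
    (φ : ℝ → E → E)
    (hφc : Continuous fun p : ℝ × E => φ p.1 p.2)
    (hφ0 : ∀ x, φ 0 x = x)
    (hφadd : ∀ s t x, φ (s + t) x = φ s (φ t x))
    (hφode : ∀ x t, HasDerivAt (fun s : ℝ => φ s x) (Y (φ t x)) t)
    -- (N, L) is an index pair: closed, (i), (ii), cl(N − L) isolating
    (N L : Set E) (hN : IsClosed N) (hL : IsClosed L) (hLN : L ⊆ N)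
    (hpos : ∀ x ∈ L, ∀ t ≥ (0 : ℝ), (∀ s ∈ Set.Icc 0 t, φ s x ∈ N) →
      ∀ s ∈ Set.Icc 0 t, φ s x ∈ L)
    (hexit : ∀ x ∈ N, ¬ (∀ t ≥ (0 : ℝ), φ t x ∈ N) →
      ∃ t ≥ (0 : ℝ), (∀ s ∈ Set.Icc 0 t, φ s x ∈ N) ∧ φ t x ∈ L)
    (hiso : ∀ x ∈ closure (N \ L), (∀ t : ℝ, φ t x ∈ closure (N \ L)) →
      x ∈ interior (closure (N \ L)))
    -- f is bounded on V = cl(N − L)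
    (hfb : ∃ C, ∀ x ∈ closure (N \ L), |f x| ≤ C)
    -- f satisfies the Palais–Smale condition in V
    (hPS : ∀ u : ℕ → E, (∀ n, u n ∈ closure (N \ L)) →
      (∃ C, ∀ n, |f (u n)| ≤ C) →
      Filter.Tendsto (fun n => ‖fderiv ℝ f (u n)‖) Filter.atTop (nhds 0) →
      ∃ x : E, ∃ σ : ℕ → ℕ, StrictMono σ ∧
        Filter.Tendsto (u ∘ σ) Filter.atTop (nhds x))
    -- f has no critical points in L ∩ V
    (hnc : ∀ x ∈ L ∩ closure (N \ L), fderiv ℝ f x ≠ 0)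
    -- (N, L) is a regular index pair
    (hreg : Continuous (tauPlus φ N L))
    (n : ℕ)
    -- x 1, …, x n are exactly the critical points of f in V
    (x : Fin n → E) (hxinj : Function.Injective x)
    (hcrit : ∀ z : E, (z ∈ closure (N \ L) ∧ fderiv ℝ f z = 0) ↔ ∃ i, x i = z)
    -- U i ⊆ N − L is a neighborhood of x i in N
    (U : Fin n → Set E) (hU1 : ∀ i, U i ⊆ N \ L)
    (hU2 : ∀ i, U i ∈ nhdsWithin (x i) N) :
    -- N = (φ♮^{t₀})⁻¹(L) ∪ ⋃ (φ♮^{tᵢ})⁻¹(Uᵢ), where φ♮^t(z) = φ^{min(t, τ₊(z))}(z)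
    ∃ t : Fin (n + 1) → ℝ, (∀ i, 0 ≤ t i) ∧
      ∀ z : N,
        φ ((min (ENNReal.ofReal (t 0)) (tauPlus φ N L z)).toReal) (z : E) ∈ L ∨
        ∃ i : Fin n,
          φ ((min (ENNReal.ofReal (t i.succ)) (tauPlus φ N L z)).toReal) (z : E) ∈ U i := by
  set V := closure (N \ L)
  have hx : ∀ z ∈ V, fderiv ℝ f z = 0 → ∃ i, x i = z := fun z hz h => (hcrit z).mp ⟨hz, h⟩
  have hlow := fun {ρ : ℝ} (hρ : 0 < ρ) =>
    exists_pos_le_norm_fderiv_of_palaisSmale hf isClosed_closure hfb hPS hx hρ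
  have hαpos : ∀ {δ : ℝ}, 0 < δ → 0 < α δ := fun {δ} hδ => by
    have := hα1 self_mem_Ici hδ.le hδ
    rwa [hα3] at this
  obtain ⟨C, hC, hYC⟩ : ∃ C > 0, ∀ z, ‖Y z‖ ≤ C := by
    obtain ⟨C, hC⟩ := hYb
    exact ⟨max C 1, by positivity, fun z => (hC z).trans (le_max_left _ _)⟩
  have hfφ : ∀ z t, HasDerivAt (fun s => f (φ s z)) (fderiv ℝ f (φ t z) (Y (φ t z))) t :=
    fun z t =>
      (hf.differentiable one_ne_zero (φ t z)).hasFDerivAt.comp_hasDerivAt t (hφode z t)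
  have hfY0 : ∀ z, 0 ≤ fderiv ℝ f z (Y z) := fun z => (hα4 _ (norm_nonneg _)).trans (hYg z)
  have hfY : ∀ {δ z}, 0 < δ → δ ≤ ‖fderiv ℝ f z‖ → α δ ≤ fderiv ℝ f z (Y z) :=
    fun hδ h => (hα1.monotoneOn hδ.le (norm_nonneg _) h).trans (hYg _)
  have hmono : ∀ z {s t}, s ≤ t → f (φ s z) ≤ f (φ t z) := fun z s t hst => by
    simpa using mul_sub_le_sub_of_le_hasDerivAt (m := 0) hst (hfφ z) fun u _ => hfY0 _
  obtain ⟨r, hr, hrU, hrx⟩ : ∃ r > 0, (∀ i, Metric.ball (x i) r ∩ N ⊆ U i) ∧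
      ∀ i j, i ≠ j → 2 * r ≤ dist (x i) (x j) := by
    have h1 : ∀ᶠ r in 𝓝[>] (0 : ℝ), ∀ i, Metric.ball (x i) r ∩ N ⊆ U i := by
      refine eventually_all.mpr fun i => ?_
      obtain ⟨ε, hε, h⟩ := Metric.mem_nhdsWithin_iff.mp (hU2 i)
      filter_upwards [Ioo_mem_nhdsGT hε] with r hr
      exact (inter_subset_inter_left _ (Metric.ball_subset_ball hr.2.le)).trans h
    have h2 : ∀ᶠ r in 𝓝[>] (0 : ℝ), ∀ i j, i ≠ j → 2 * r ≤ dist (x i) (x j) := by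
      refine eventually_all.mpr fun i => eventually_all.mpr fun j => ?_
      by_cases hij : i = j
      · simp [hij]
      filter_upwards [Ioo_mem_nhdsGT (half_pos (dist_pos.mpr (hxinj.ne hij)))] with r hr _
      linarith [hr.2]
    obtain ⟨r, ⟨h1, h2⟩, hr⟩ := ((h1.and h2).and self_mem_nhdsWithin).exists
    exact ⟨r, hr, h1, h2⟩
  obtain ⟨δ, hδ, hδV⟩ := hlow (half_pos hr)
  set g := α δ * (r / (2 * C))
  have hg0 : 0 < g := mul_pos (hαpos hδ) (by positivity)
  obtain ⟨ρ, hρ, hρr, hρf⟩ : ∃ ρ > 0, ρ ≤ r / 2 ∧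
      ∀ i, ∀ z ∈ Metric.ball (x i) ρ, |f z - f (x i)| < g / 2 := by
    have h : ∀ᶠ ρ in 𝓝[>] (0 : ℝ), ∀ i, ∀ z ∈ Metric.ball (x i) ρ, |f z - f (x i)| < g / 2 := by
      refine eventually_all.mpr fun i => ?_
      obtain ⟨ε, hε, h⟩ := Metric.continuousAt_iff.mp hf.continuous.continuousAt (g / 2) (half_pos hg0)
      filter_upwards [Ioo_mem_nhdsGT hε] with ρ hρ z hz
      exact h ((Metric.mem_ball.mp hz).trans hρ.2)
    obtain ⟨ρ, h, hρ⟩ := (h.and (Ioo_mem_nhdsGT (half_pos hr))).exists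
    exact ⟨ρ, hρ.1, hρ.2.le, h⟩
  obtain ⟨δ', hδ', hδV'⟩ := hlow hρ
  obtain ⟨M, hM⟩ := hfb
  set K := (2 * |M| + 1) / α δ'
  have hK0 : 0 ≤ K := div_nonneg (by positivity) (hαpos hδ').le
  have hKα : α δ' * K = 2 * |M| + 1 := mul_div_cancel₀ _ (hαpos hδ').ne'
  set e := Tuple.sort (f ∘ x)
  refine ⟨Fin.cons ((n + 1) * K) fun i => ((e.symm i : ℕ) + 1) * K, ?_, fun z => ?_⟩
  · refine Fin.cases ?_ fun i => ?_
    · simp only [Fin.cons_zero]; positivity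
    · simp only [Fin.cons_succ]; positivity
  simp only [Fin.cons_zero, Fin.cons_succ]
  rcases le_or_gt (tauPlus φ N L z) (ENNReal.ofReal ((n + 1) * K)) with hτ | hτ
  · left
    rw [min_eq_right hτ]
    exact apply_tauPlus_mem (fun z => hφc.comp (by fun_prop : Continuous fun t : ℝ => (t, z)))
      hφ0 hφadd hN hL hexit (ne_top_of_le_ne_top ENNReal.ofReal_ne_top hτ)
  right
  have hmem : ∀ s, 0 ≤ s → s ≤ (n + 1) * K → φ s (z : E) ∈ N \ L :=
    fun s => mem_diff_of_lt_tauPlus hτ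
  have hmemV : ∀ s, 0 ≤ s → s ≤ (n + 1) * K → φ s (z : E) ∈ V :=
    fun s h1 h2 => subset_closure (hmem s h1 h2)
  obtain ⟨k, hk⟩ := exists_mem_at_ranked_time (c := fun s => φ s (z : E))
    (W := fun i => Metric.ball (x i) ρ) (B := fun i => Metric.ball (x i) r)
    (val := f ∘ x) (e := e) (Tuple.monotone_sort _) hK0
    (fun i j hij => Metric.ball_disjoint_ball (by linarith [hrx i j hij]))
    (by
      intro i j v t u hv hvt htu hu hvW htB huW
      have hcross : f (φ v z) + g ≤ f (φ t z) := by
        refine add_le_of_crossing_annulus (p := x i) hC (hαpos hδ).le (hφode z)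
          (fun u => hYC _) (hfφ z) (fun u => hfY0 _) (fun w hw h1 h2 => hfY hδ ?_) hvt
          ((Metric.mem_ball.mp hvW).le.trans hρr) (by simpa using htB)
        refine hδV _ (hmemV w (hv.trans hw.1) (hw.2.trans (htu.trans hu))) fun l => ?_
        by_cases hil : i = l
        · rwa [← hil]
        · linarith [hrx i l hil, dist_triangle_left (x i) (x l) (φ w z)]
      have h1 := abs_lt.mp (hρf i _ hvW)
      have h2 := abs_lt.mp (hρf j _ huW)
      have h3 := hmono z htu
      simp only [Function.comp_apply]
      linarith [h1.1, h2.2])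
    (by
      intro a ha haK
      by_contra! hout
      have hgain : α δ' * (a + K - a) ≤ f (φ (a + K) z) - f (φ a z) := by
        refine mul_sub_le_sub_of_le_hasDerivAt (by linarith) (hfφ z) fun w hw => hfY hδ' ?_
        refine hδV' _ (hmemV w (ha.trans hw.1.le) (hw.2.le.trans haK)) fun l => ?_
        simpa using hout w (Ioo_subset_Icc_self hw) l
      rw [add_sub_cancel_left, hKα] at hgain
      have h1 := abs_le.mp (hM _ (hmemV a ha (by linarith)))
      have h2 := abs_le.mp (hM _ (hmemV (a + K) (by linarith) haK))
      linarith [h1.1, h2.2, le_abs_self M])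
  have hkn : ((k : ℕ) + 1 : ℝ) * K ≤ (n + 1) * K := by
    gcongr
    exact k.2.le
  refine ⟨e k, ?_⟩
  rw [Equiv.symm_apply_apply, min_eq_left ((ENNReal.ofReal_le_ofReal hkn).trans hτ.le),
    ENNReal.toReal_ofReal (by positivity)]
  exact hrU _ ⟨hk, (hmem _ (by positivity) hkn).1⟩
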